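/- For every positive integer n there exists an infinitely differentiable simple closed curve in the plane, bounding a convex region, which has exactly n inscribed squares. Precisely: for every n ≥ 1 there exist a map γ : ℝ → ℂ that is infinitely differentiable (ContDiff ℝ ⊤), periodic with period 2π, injective on [0, 2π), with derivative nowhere vanishing, and a compact convex set K ⊆ ℂ with nonempty interior such that the image of γ equals the frontier of K, and the collection of squares inscribed in the image of γ has cardinality exactly n. -/

import Mathlib

open Complex Real Set

/-- A set `S ⊆ ℂ` is a square if it consists of the four points
`p, p + w, p + w + i·w, p + i·w` for some `p` and some `w ≠ 0`. -/
def IsSquarePts (S : Set ℂ) : Prop :=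
  ∃ p w : ℂ, w ≠ 0 ∧ S = {p, p + w, p + w + Complex.I * w, p + Complex.I * w}

/-- The collection of squares inscribed in a set `C ⊆ ℂ`. -/
def InscribedSquares (C : Set ℂ) : Set (Set ℂ) :=
  {S | IsSquarePts S ∧ S ⊆ C}

/-- The open first quadrant. -/
def openQuadrant : Set ℂ := {z | 0 < z.re ∧ 0 < z.im}

/-- The orbit of `z` under rotation by quarter turns about the origin. -/
def quarterTurnOrbit (z : ℂ) : Set ℂ := {z, I * z, -z, -(I * z)}

/-- The polar curve of angle `t` and radius `1 / u t`. -/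
noncomputable def polarCurve (u : ℝ → ℝ) (t : ℝ) : ℂ :=
  (((u t)⁻¹ : ℝ) : ℂ) * Complex.exp (t * I)

/-- The linear functional equal to `1` on the tangent line of `polarCurve u` at angle `s`. -/
noncomputable def tangentFunctional (u : ℝ → ℝ) (s : ℝ) (z : ℂ) : ℝ :=
  z.re * (u s * Real.cos s - deriv u s * Real.sin s) +
    z.im * (u s * Real.sin s + deriv u s * Real.cos s)

/-- The intersection of the half-planes bounded by the tangent lines of `polarCurve u`. -/
def tangentBody (u : ℝ → ℝ) : Set ℂ := {z | ∀ s, tangentFunctional u s z ≤ 1}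

theorem norm_eq_one_iff_sq (z : ℂ) : ‖z‖ = 1 ↔ z.re ^ 2 + z.im ^ 2 = 1 := by
  rw [← Complex.sq_norm_sub_sq_re z, ← sq_eq_sq₀ (norm_nonneg z) zero_le_one]
  constructor <;> intro h <;> linarith

theorem norm_le_one_iff_sq (z : ℂ) : ‖z‖ ≤ 1 ↔ z.re ^ 2 + z.im ^ 2 ≤ 1 := by
  rw [← Complex.sq_norm_sub_sq_re z, ← sq_le_sq₀ (norm_nonneg z) zero_le_one]
  constructor <;> intro h <;> linarith

/-! ### Squares inscribed in a dented circle -/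

section Squares

theorem isSquarePts_quarterTurnOrbit {z : ℂ} (hz : z ≠ 0) :
    IsSquarePts (quarterTurnOrbit z) := by
  refine ⟨z, (I - 1) * z, mul_ne_zero ?_ hz, ?_⟩
  · intro h
    simpa using congrArg Complex.im h
  · have h : I * I = -1 := I_mul_I
    unfold quarterTurnOrbit
    congr 1
    · congr 1
      · ring
      · congr 1
        · linear_combination -z * h
        · congr 1
          linear_combination -z * h

theorem quarterTurnOrbit_I_mul (z : ℂ) :
    quarterTurnOrbit (I * z) = quarterTurnOrbit z := by
  have h : I * (I * z) = -z := by rw [← mul_assoc, I_mul_I]; ring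
  ext x
  simp only [quarterTurnOrbit, h, neg_neg, mem_insert_iff, mem_singleton_iff]
  tauto

theorem quarterTurnOrbit_injOn :
    InjOn quarterTurnOrbit {z : ℂ | 0 < z.re ∧ 0 ≤ z.im} := by
  rintro z ⟨h1, h2⟩ w ⟨h3, h4⟩ h
  have hz : z ∈ quarterTurnOrbit w := h ▸ (by simp [quarterTurnOrbit])
  rcases hz with rfl | rfl | rfl | hz
  · rfl
  · simp at h1; linarith
  · simp at h1; linarith
  · rw [mem_singleton_iff] at hz
    subst hz
    simp at h2; linarith

/-- The points `a, b, c, d` are the consecutive vertices of a counterclockwise square. -/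
structure IsSquareQuad (a b c d : ℂ) : Prop where
  ne : a ≠ b
  third : c = b + I * (b - a)
  fourth : d = a + I * (b - a)

namespace IsSquareQuad

variable {a b c d : ℂ}

theorem rotate (h : IsSquareQuad a b c d) : IsSquareQuad b c d a := by
  obtain ⟨h1, rfl, rfl⟩ := h
  have hI : I * I = -1 := I_mul_I
  refine ⟨fun h => h1 ?_, ?_, ?_⟩
  · simpa [sub_eq_zero, eq_comm] using h
  · linear_combination (a - b) * hI
  · linear_combination (a - b) * hI

theorem eq_quarterTurnOrbit (h : IsSquareQuad a b c d) (hb : ‖b‖ = 1) (hc : ‖c‖ = 1)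
    (hd : ‖d‖ = 1) : ‖a‖ = 1 ∧ ({a, b, c, d} : Set ℂ) = quarterTurnOrbit a := by
  obtain ⟨hne, rfl, rfl⟩ := h
  rw [norm_eq_one_iff_sq] at *
  simp only [add_re, add_im, mul_re, mul_im, I_re, I_im, sub_re, sub_im] at hc hd
  have hpos : (b.re - a.re) ^ 2 + (b.im - a.im) ^ 2 ≠ 0 := by
    intro h
    apply hne
    apply Complex.ext <;> nlinarith [sq_nonneg (b.re - a.re), sq_nonneg (b.im - a.im)]
  have e1 : b.re = -a.im := by
    apply mul_left_cancel₀ hpos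
    linear_combination (1 / 2) * ((b.re - a.re) * (hc - hd) - (b.im - a.im) * (hc - hb)
      + (b.im - a.im) * (hc - hd) + (b.re - a.re) * (hc - hb))
  have e2 : b.im = a.re := by
    apply mul_left_cancel₀ hpos
    linear_combination (1 / 2) * (-(b.re - a.re) * (hc - hd) + (b.im - a.im) * (hc - hb)
      + (b.im - a.im) * (hc - hd) + (b.re - a.re) * (hc - hb))
  have hbI : b = I * a := by apply Complex.ext <;> simp [e1, e2]
  have hI : I * I = -1 := I_mul_I
  constructor
  · rw [e1, e2] at hb
    linarith
  · subst hbI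
    unfold quarterTurnOrbit
    rw [show I * a + I * (I * a - a) = -a by linear_combination a * hI,
      show a + I * (I * a - a) = -(I * a) by linear_combination a * hI]

theorem not_corner (h : IsSquareQuad a b c d)
    (hab : (a - b).re * (a - b).im < 0) (hcb : (c - b).re * (c - b).im < 0) : False := by
  obtain ⟨-, rfl, rfl⟩ := h
  simp at hab hcb
  nlinarith

theorem not_edge (h : IsSquareQuad a b c d) (ha : a ∈ openQuadrant) (hb : b ∈ openQuadrant)
    (ha1 : ‖a‖ ≤ 1) (hc : c ∉ openQuadrant) (hc1 : ‖c‖ = 1) (hd1 : ‖d‖ = 1) : False := by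
  obtain ⟨hne, rfl, rfl⟩ := h
  obtain ⟨w, rfl⟩ : ∃ w, b = a + w := ⟨b - a, by ring⟩
  rw [norm_le_one_iff_sq] at ha1
  rw [norm_eq_one_iff_sq] at hc1 hd1
  obtain ⟨h1, h2⟩ := ha
  obtain ⟨h3, h4⟩ := hb
  have hw : w.re ≠ 0 ∨ w.im ≠ 0 := by
    by_contra! h
    exact hne (Complex.ext (by simp [h.1]) (by simp [h.2]))
  simp only [openQuadrant, mem_ofPred_eq, add_re, add_im, mul_re, mul_im, I_re, I_im,
    add_sub_cancel_left, zero_mul, one_mul, zero_sub, zero_add] at *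
  generalize w.re = p at *
  generalize w.im = q at *
  generalize a.re = x at *
  generalize a.im = y at *
  have horth : (2 * x + p) * p + (2 * y + q) * q = 0 := by linear_combination hc1 - hd1
  have hin : 0 ≤ (2 * y + q) * p - (2 * x + p) * q + p ^ 2 + q ^ 2 := by linarith
  have hX : 0 < 2 * x + p := by linarith
  have hY : 0 < 2 * y + q := by linarith
  rcases lt_trichotomy p 0 with hp | hp | hp
  · have hq : 0 < q := by
      by_contra! h
      nlinarith [mul_pos_of_neg_of_neg hp (neg_lt_zero.2 hX)]
    by_cases hqX : 2 * x + p ≤ q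
    · by_cases hpY : 2 * y + q ≤ -p
      · linarith
      · push Not at hpY
        nlinarith [mul_le_mul_of_nonpos_right hqX hp.le]
    · push Not at hqX
      have hpY : -p < 2 * y + q := by
        by_contra! h
        nlinarith [mul_lt_mul_of_neg_right hqX hp]
      nlinarith
  · subst hp
    have : (2 * y + q) * q = 0 := by linarith
    simp [(mul_eq_zero.1 this).resolve_left hY.ne'] at hw
  · have hq : q < 0 := by
      by_contra! h
      nlinarith [mul_pos hX hp, mul_nonneg hY.le h]
    exact hc ⟨by linarith, by linarith⟩

theorem not_diagonal (h : IsSquareQuad a b c d) (ha : a ∈ openQuadrant)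
    (hac : (a - c).re * (a - c).im < 0) (hb : ‖b‖ = 1) (hd : ‖d‖ = 1) : False := by
  obtain ⟨hne, rfl, rfl⟩ := h
  obtain ⟨w, rfl⟩ : ∃ w, b = a + w := ⟨b - a, by ring⟩
  rw [norm_eq_one_iff_sq] at hb hd
  obtain ⟨h1, h2⟩ := ha
  simp only [add_re, add_im, mul_re, mul_im, I_re, I_im, sub_re, sub_im, add_sub_cancel_left,
    zero_mul, one_mul, zero_sub, zero_add] at *
  generalize w.re = p at *
  generalize w.im = q at *
  have h3 : a.re * (p + q) = a.im * (p - q) := by linear_combination (hb - hd) / 2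
  have h4 : a.re * ((p - q) * (p + q)) = a.im * (p - q) ^ 2 := by
    linear_combination (p - q) * h3
  nlinarith [mul_nonneg h2.le (sq_nonneg (p - q))]

end IsSquareQuad

/-- A subset of the unit disk that agrees with the unit circle outside the open first quadrant
and forms a strictly decreasing arc inside it. -/
structure IsDentedCircle (C : Set ℂ) : Prop where
  norm_le_one : ∀ z ∈ C, ‖z‖ ≤ 1
  norm_eq_one : ∀ z ∈ C, z ∉ openQuadrant → ‖z‖ = 1
  mem_of_norm_eq_one : ∀ z, ‖z‖ = 1 → z ∉ openQuadrant → z ∈ C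
  decreasing : ∀ z ∈ C, ∀ w ∈ C, z ∈ openQuadrant → w ∈ openQuadrant → z ≠ w →
    (z - w).re * (z - w).im < 0

namespace IsDentedCircle

variable {C : Set ℂ} {a b c d : ℂ}

theorem eq_quarterTurnOrbit_of_mem_openQuadrant (hC : IsDentedCircle C)
    (h : IsSquareQuad a b c d) (ha : a ∈ C) (hb : b ∈ C) (hc : c ∈ C) (hd : d ∈ C)
    (haQ : a ∈ openQuadrant) : ‖a‖ = 1 ∧ ({a, b, c, d} : Set ℂ) = quarterTurnOrbit a := by
  have corner {a b c d : ℂ} (h : IsSquareQuad a b c d) (ha : a ∈ C) (hb : b ∈ C) (hc : c ∈ C)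
      (haQ : a ∈ openQuadrant) (hbQ : b ∈ openQuadrant) (hcQ : c ∈ openQuadrant) : False :=
    h.not_corner (hC.decreasing a ha b hb haQ hbQ h.ne)
      (hC.decreasing c hc b hb hcQ hbQ h.rotate.ne.symm)
  have edge {a b c d : ℂ} (h : IsSquareQuad a b c d) (ha : a ∈ C) (hb : b ∈ C) (hc : c ∈ C)
      (hd : d ∈ C) (haQ : a ∈ openQuadrant) (hbQ : b ∈ openQuadrant) : False := by
    by_cases hcQ : c ∈ openQuadrant
    · exact corner h ha hb hc haQ hbQ hcQ
    by_cases hdQ : d ∈ openQuadrant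
    · exact corner h.rotate.rotate.rotate hd ha hb hdQ haQ hbQ
    exact h.not_edge haQ hbQ (hC.norm_le_one a ha) hcQ (hC.norm_eq_one c hc hcQ)
      (hC.norm_eq_one d hd hdQ)
  have hb1 := hC.norm_eq_one b hb fun hbQ => edge h ha hb hc hd haQ hbQ
  have hd1 := hC.norm_eq_one d hd fun hdQ => edge h.rotate.rotate.rotate hd ha hb hc hdQ haQ
  refine h.eq_quarterTurnOrbit hb1 (hC.norm_eq_one c hc fun hcQ => ?_) hd1
  by_cases hac : a = c
  · obtain ⟨hne, h3, -⟩ := h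
    apply hne
    have : (1 + I) * (b - a) = 0 := by linear_combination -h3 - hac
    have hI : (1 + I : ℂ) ≠ 0 := fun h => by simpa using congrArg Complex.im h
    exact (sub_eq_zero.1 ((mul_eq_zero.1 this).resolve_left hI)).symm
  · exact h.not_diagonal haQ (hC.decreasing a ha c hc haQ hcQ hac) hb1 hd1

theorem inscribedSquares_eq (hC : IsDentedCircle C) :
    InscribedSquares C =
      quarterTurnOrbit '' insert 1 {z | z ∈ C ∧ z ∈ openQuadrant ∧ ‖z‖ = 1} := by
  ext S
  constructor
  · rintro ⟨⟨p, w, hw, rfl⟩, hS⟩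
    have h : IsSquareQuad p (p + w) (p + w + I * w) (p + I * w) :=
      ⟨by simpa using hw, by simp, by simp⟩
    obtain ⟨a, ha⟩ : ∃ a, a = p := ⟨_, rfl⟩
    generalize p + w + I * w = c at *
    generalize p + I * w = d at *
    generalize p + w = b at *
    subst ha
    have ha : a ∈ C := hS (by simp)
    have hb : b ∈ C := hS (by simp)
    have hc : c ∈ C := hS (by simp)
    have hd : d ∈ C := hS (by simp)
    have cycle (a b c d : ℂ) : ({a, b, c, d} : Set ℂ) = {b, c, d, a} := by
      ext
      simp only [mem_insert_iff, mem_singleton_iff]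
      tauto
    by_cases haQ : a ∈ openQuadrant
    · obtain ⟨h1, h2⟩ := hC.eq_quarterTurnOrbit_of_mem_openQuadrant h ha hb hc hd haQ
      exact ⟨a, Or.inr ⟨ha, haQ, h1⟩, h2.symm⟩
    by_cases hbQ : b ∈ openQuadrant
    · obtain ⟨h1, h2⟩ := hC.eq_quarterTurnOrbit_of_mem_openQuadrant h.rotate hb hc hd ha hbQ
      exact ⟨b, Or.inr ⟨hb, hbQ, h1⟩, by rw [← h2, cycle a]⟩
    by_cases hcQ : c ∈ openQuadrant
    · obtain ⟨h1, h2⟩ :=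
        hC.eq_quarterTurnOrbit_of_mem_openQuadrant h.rotate.rotate hc hd ha hb hcQ
      exact ⟨c, Or.inr ⟨hc, hcQ, h1⟩, by rw [← h2, cycle a, cycle b]⟩
    by_cases hdQ : d ∈ openQuadrant
    · obtain ⟨h1, h2⟩ :=
        hC.eq_quarterTurnOrbit_of_mem_openQuadrant h.rotate.rotate.rotate hd ha hb hc hdQ
      exact ⟨d, Or.inr ⟨hd, hdQ, h1⟩, by rw [← h2, cycle a, cycle b, cycle c]⟩
    obtain ⟨h1, h2⟩ := h.eq_quarterTurnOrbit (hC.norm_eq_one b hb hbQ)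
      (hC.norm_eq_one c hc hcQ) (hC.norm_eq_one d hd hdQ)
    refine ⟨1, Or.inl rfl, ?_⟩
    rw [h2]
    have hQ : ∀ z ∈ quarterTurnOrbit a, z ∉ openQuadrant := by
      rw [← h2]
      simp [haQ, hbQ, hcQ, hdQ]
    have q1 := hQ a (by simp [quarterTurnOrbit])
    have q2 := hQ (I * a) (by simp [quarterTurnOrbit])
    have q3 := hQ (-a) (by simp [quarterTurnOrbit])
    have q4 := hQ (-(I * a)) (by simp [quarterTurnOrbit])
    simp [openQuadrant] at q1 q2 q3 q4
    rw [norm_eq_one_iff_sq] at h1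
    have hI : quarterTurnOrbit I = quarterTurnOrbit 1 := by
      simpa using quarterTurnOrbit_I_mul 1
    have hneg (z : ℂ) : quarterTurnOrbit (-z) = quarterTurnOrbit z := by
      rw [← quarterTurnOrbit_I_mul z, ← quarterTurnOrbit_I_mul (I * z), ← mul_assoc, I_mul_I,
        neg_one_mul]
    have key : a = 1 ∨ a = -1 ∨ a = I ∨ a = -I := by
      have hz : a.re = 0 ∨ a.im = 0 := by
        by_contra! hz
        rcases lt_or_gt_of_ne hz.1 with h3 | h3 <;> rcases lt_or_gt_of_ne hz.2 with h4 | h4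
        · linarith [q3 h3]
        · linarith [q4 h4]
        · linarith [q2 h4]
        · linarith [q1 h3]
      rcases hz with hz | hz
      · have : a.im ^ 2 = 1 := by simpa [hz] using h1
        rcases (sq_eq_sq_iff_eq_or_eq_neg.1 (this.trans (one_pow 2).symm)) with h5 | h5
        · exact Or.inr (Or.inr (Or.inl (Complex.ext (by simp [hz]) (by simp [h5]))))
        · exact Or.inr (Or.inr (Or.inr (Complex.ext (by simp [hz]) (by simp [h5]))))
      · have : a.re ^ 2 = 1 := by simpa [hz] using h1
        rcases (sq_eq_sq_iff_eq_or_eq_neg.1 (this.trans (one_pow 2).symm)) with h5 | h5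
        · exact Or.inl (Complex.ext (by simp [h5]) (by simp [hz]))
        · exact Or.inr (Or.inl (Complex.ext (by simp [h5]) (by simp [hz])))
    rcases key with rfl | rfl | rfl | rfl
    · rfl
    · rw [hneg]
    · exact hI.symm
    · rw [hneg, hI]
  · rintro ⟨z, hz, rfl⟩
    have hz1 : ‖z‖ = 1 := by
      rcases hz with rfl | hz
      · simp
      · exact hz.2.2
    refine ⟨isSquarePts_quarterTurnOrbit (norm_ne_zero_iff.1 (by simp [hz1])), ?_⟩
    have hz' : 0 < z.re ∧ 0 ≤ z.im := by
      rcases hz with rfl | hz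
      · simp
      · exact ⟨hz.2.1.1, hz.2.1.2.le⟩
    rintro x (rfl | rfl | rfl | hx)
    · rcases hz with rfl | hz
      · exact hC.mem_of_norm_eq_one _ (by simp) (by simp [openQuadrant])
      · exact hz.1
    · refine hC.mem_of_norm_eq_one _ (by simpa) fun h => ?_
      simp [openQuadrant] at h
      linarith
    · refine hC.mem_of_norm_eq_one _ (by simpa) fun h => ?_
      simp [openQuadrant] at h
      linarith
    · rw [mem_singleton_iff] at hx
      subst hx
      refine hC.mem_of_norm_eq_one _ (by simpa) fun h => ?_
      simp [openQuadrant] at h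
      linarith

theorem ncard_inscribedSquares (hC : IsDentedCircle C)
    (hfin : {z | z ∈ C ∧ z ∈ openQuadrant ∧ ‖z‖ = 1}.Finite) :
    (InscribedSquares C).ncard = {z | z ∈ C ∧ z ∈ openQuadrant ∧ ‖z‖ = 1}.ncard + 1 := by
  rw [hC.inscribedSquares_eq, InjOn.ncard_image, ncard_insert_of_notMem _ hfin]
  · simp [openQuadrant]
  · refine quarterTurnOrbit_injOn.mono ?_
    rintro z (rfl | hz)
    · simp
    · exact ⟨hz.2.1.1, hz.2.1.2.le⟩

end IsDentedCircle

end Squares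

/-! ### Convex curves in polar coordinates -/

section PolarCurve

variable {u : ℝ → ℝ}

theorem polarCurve_re (t : ℝ) : (polarCurve u t).re = (u t)⁻¹ * Real.cos t := by
  rw [polarCurve, re_ofReal_mul, exp_ofReal_mul_I_re]

theorem polarCurve_im (t : ℝ) : (polarCurve u t).im = (u t)⁻¹ * Real.sin t := by
  rw [polarCurve, im_ofReal_mul, exp_ofReal_mul_I_im]

theorem norm_polarCurve (h : 0 < u t) : ‖polarCurve u t‖ = (u t)⁻¹ := by
  rw [polarCurve, norm_mul, norm_exp_ofReal_mul_I, mul_one, norm_real,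
    Real.norm_of_nonneg (inv_nonneg.2 h.le)]

theorem tangentFunctional_eq (s : ℝ) (z : ℂ) :
    tangentFunctional u s z =
      ‖z‖ * (u s * Real.cos (arg z - s) + deriv u s * Real.sin (arg z - s)) := by
  rw [tangentFunctional, ← norm_mul_cos_arg z, ← norm_mul_sin_arg z, Real.cos_sub, Real.sin_sub]
  ring

theorem convex_tangentBody : Convex ℝ (tangentBody u) := by
  intro z hz w hw a b ha hb hab s
  have h1 := mul_le_mul_of_nonneg_left (hz s) ha
  have h2 := mul_le_mul_of_nonneg_left (hw s) hb
  have : tangentFunctional u s (a • z + b • w) =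
      a * tangentFunctional u s z + b * tangentFunctional u s w := by
    simp [tangentFunctional]
    ring
  rw [this]
  linarith

theorem continuous_tangentFunctional (s : ℝ) : Continuous (tangentFunctional u s) := by
  unfold tangentFunctional
  fun_prop

theorem isClosed_tangentBody : IsClosed (tangentBody u) := by
  rw [tangentBody, ofPred_forall]
  exact isClosed_iInter fun s => isClosed_le (continuous_tangentFunctional s) continuous_const

/-- The hypotheses under which `polarCurve u` is a smooth closed convex curve in the unit disk. -/
structure IsConvexRadial (u : ℝ → ℝ) : Prop where
  contDiff : ContDiff ℝ (⊤ : ℕ∞) u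
  periodic : Function.Periodic u (2 * π)
  one_le : ∀ t, 1 ≤ u t
  add_deriv_nonneg : ∀ t, 0 ≤ u t + deriv (deriv u) t

theorem periodic_deriv {c : ℝ} (h : Function.Periodic u c) : Function.Periodic (deriv u) c := by
  intro t
  rw [← deriv_comp_add_const]
  congr 1
  exact funext h

theorem exists_bound_of_periodic {f : ℝ → ℝ} (hf : Continuous f)
    (h : Function.Periodic f (2 * π)) : ∃ M, 0 < M ∧ ∀ t, |f t| ≤ M := by
  obtain ⟨M, hM⟩ := isCompact_Icc.exists_bound_of_continuousOn (s := Icc 0 (2 * π))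
    hf.continuousOn
  refine ⟨max M 1, by positivity, fun t => ?_⟩
  obtain ⟨s, hs, hst⟩ := h.exists_mem_Ico₀ Real.two_pi_pos t
  rw [hst]
  exact (hM s ⟨hs.1, hs.2.le⟩).trans (le_max_left _ _)

namespace IsConvexRadial

theorem pos (hu : IsConvexRadial u) (t : ℝ) : 0 < u t := zero_lt_one.trans_le (hu.one_le t)

theorem contDiff_deriv (hu : IsConvexRadial u) : ContDiff ℝ (⊤ : ℕ∞) (deriv u) :=
  (contDiff_infty_iff_deriv.1 hu.contDiff).2

theorem hasDerivAt (hu : IsConvexRadial u) (t : ℝ) : HasDerivAt u (deriv u t) t :=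
  (hu.contDiff.differentiable (by simp) t).hasDerivAt

theorem hasDerivAt_deriv (hu : IsConvexRadial u) (t : ℝ) :
    HasDerivAt (deriv u) (deriv (deriv u) t) t :=
  (hu.contDiff_deriv.differentiable (by simp) t).hasDerivAt

theorem tangent_le (hu : IsConvexRadial u) (s t : ℝ) :
    u s * Real.cos (t - s) + deriv u s * Real.sin (t - s) ≤ u t := by
  set V : ℝ → ℝ := fun s => u s * Real.cos (t - s) + deriv u s * Real.sin (t - s) with hV
  have hVper : Function.Periodic V (2 * π) := by
    intro s
    simp only [hV, hu.periodic s, periodic_deriv hu.periodic s, ← sub_sub, Real.cos_sub_two_pi,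
      Real.sin_sub_two_pi]
  have hVd (s : ℝ) : HasDerivAt V ((u s + deriv (deriv u) s) * Real.sin (t - s)) s := by
    have h1 : HasDerivAt (fun s => t - s) (-1) s := by simpa using (hasDerivAt_id s).const_sub t
    exact (((hu.hasDerivAt s).mul h1.cos).add ((hu.hasDerivAt_deriv s).mul h1.sin)).congr_deriv
      (by ring)
  have hVc : Continuous V := continuous_iff_continuousAt.2 fun s => (hVd s).continuousAt
  have hVt : V t = u t := by simp [hV]
  obtain ⟨r, hr, hrs⟩ := hVper.exists_mem_Ico Real.two_pi_pos s (t - π)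
  change V s ≤ u t
  rw [hrs, ← hVt]
  rcases le_total r t with hrt | hrt
  · refine monotoneOn_of_deriv_nonneg (convex_Icc (t - π) t) hVc.continuousOn
      (fun x _ => (hVd x).differentiableAt.differentiableWithinAt) (fun x hx => ?_)
      ⟨hr.1, hrt⟩ ⟨by linarith [Real.pi_pos], le_rfl⟩ hrt
    rw [interior_Icc] at hx
    rw [(hVd x).deriv]
    exact mul_nonneg (hu.add_deriv_nonneg x)
      (Real.sin_nonneg_of_nonneg_of_le_pi (by linarith [hx.2]) (by linarith [hx.1]))
  · refine antitoneOn_of_deriv_nonpos (convex_Icc t (t + π)) hVc.continuousOn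
      (fun x _ => (hVd x).differentiableAt.differentiableWithinAt) (fun x hx => ?_)
      ⟨le_rfl, by linarith [Real.pi_pos]⟩ ⟨hrt, by linarith [hr.2]⟩ hrt
    rw [interior_Icc] at hx
    rw [(hVd x).deriv]
    exact mul_nonpos_of_nonneg_of_nonpos (hu.add_deriv_nonneg x)
      (Real.sin_nonpos_of_nonpos_of_neg_pi_le (by linarith [hx.1]) (by linarith [hx.2]))

theorem tangentFunctional_le (hu : IsConvexRadial u) (s : ℝ) (z : ℂ) :
    tangentFunctional u s z ≤ ‖z‖ * u (arg z) := by
  rw [tangentFunctional_eq]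
  exact mul_le_mul_of_nonneg_left (hu.tangent_le s _) (norm_nonneg z)

theorem mem_tangentBody_iff (hu : IsConvexRadial u) (z : ℂ) :
    z ∈ tangentBody u ↔ ‖z‖ * u (arg z) ≤ 1 := by
  refine ⟨fun h => ?_, fun h s => (hu.tangentFunctional_le s z).trans h⟩
  simpa [tangentFunctional_eq] using h (arg z)

theorem norm_mul_arg_polarCurve (hu : IsConvexRadial u) (t : ℝ) :
    ‖polarCurve u t‖ * u (arg (polarCurve u t)) = 1 := by
  have h : u (arg (polarCurve u t)) = u t := by
    rw [polarCurve, arg_real_mul _ (inv_pos.2 (hu.pos t)), arg_exp_mul_I, toIocMod]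
    exact hu.periodic.sub_zsmul_eq _
  rw [h, norm_polarCurve (hu.pos t), inv_mul_cancel₀ (hu.pos t).ne']

theorem mem_range_polarCurve_iff (hu : IsConvexRadial u) (z : ℂ) :
    z ∈ range (polarCurve u) ↔ ‖z‖ * u (arg z) = 1 := by
  constructor
  · rintro ⟨t, rfl⟩
    exact hu.norm_mul_arg_polarCurve t
  · intro h
    refine ⟨arg z, ?_⟩
    rw [polarCurve, ← eq_inv_of_mul_eq_one_left h, norm_mul_exp_arg_mul_I]

theorem contDiff_polarCurve (hu : IsConvexRadial u) : ContDiff ℝ (⊤ : ℕ∞) (polarCurve u) := by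
  have h1 : ContDiff ℝ (⊤ : ℕ∞) fun t => (((u t)⁻¹ : ℝ) : ℂ) :=
    ofRealCLM.contDiff.comp (hu.contDiff.inv fun t => (hu.pos t).ne')
  exact h1.mul ((ofRealCLM.contDiff.mul contDiff_const).cexp)

theorem periodic_polarCurve (hu : IsConvexRadial u) : Function.Periodic (polarCurve u) (2 * π) := by
  intro t
  apply Complex.ext <;> simp [polarCurve_re, polarCurve_im, hu.periodic t]

theorem injOn_polarCurve (hu : IsConvexRadial u) : InjOn (polarCurve u) (Ico 0 (2 * π)) := by
  intro s hs t ht h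
  have h1 : u s = u t := by
    rw [← inv_inj, ← norm_polarCurve (hu.pos s), ← norm_polarCurve (hu.pos t), h]
  have h2 : Complex.exp (s * I) = Complex.exp (t * I) := by
    rw [polarCurve, polarCurve, h1] at h
    exact mul_left_cancel₀ (by simpa using (hu.pos t).ne') h
  rw [Complex.exp_eq_exp_iff_exists_int] at h2
  obtain ⟨n, hn⟩ := h2
  have h3 : s = t + n * (2 * π) := by
    have := congrArg Complex.im hn
    simpa using this
  have h4 : n = 0 := by
    have h5 : (n : ℝ) < 1 := by nlinarith [hs.2, ht.1, Real.pi_pos]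
    have h6 : (-1 : ℝ) < n := by nlinarith [hs.1, ht.2, Real.pi_pos]
    have h5' : n < 1 := by exact_mod_cast h5
    have h6' : -1 < n := by exact_mod_cast h6
    omega
  simpa [h4] using h3

theorem deriv_polarCurve_ne_zero (hu : IsConvexRadial u) (t : ℝ) : deriv (polarCurve u) t ≠ 0 := by
  intro h0
  have hd : HasDerivAt (polarCurve u) 0 t := by
    have := (hu.contDiff_polarCurve.differentiable (by simp) t).hasDerivAt
    rwa [h0] at this
  have h1 := (hu.hasDerivAt t).ofReal_comp.mul hd
  have h2 : ((fun s => (u s : ℂ)) * polarCurve u) = fun s : ℝ => Complex.exp (s * I) := by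
    funext s
    have : (u s : ℂ) ≠ 0 := by exact_mod_cast (hu.pos s).ne'
    simp [polarCurve, this]
  have h3 : HasDerivAt (fun s : ℝ => Complex.exp (s * I)) (Complex.exp (t * I) * (1 * I)) t :=
    ((hasDerivAt_id t).ofReal_comp.mul_const I).cexp
  have h4 := (h1.congr_of_eventuallyEq (.of_eq h2.symm) :
    HasDerivAt (fun s : ℝ => Complex.exp (s * I)) _ t).unique h3
  have h5 : ((deriv u t * (u t)⁻¹ : ℝ) : ℂ) = I := by
    apply mul_right_cancel₀ (Complex.exp_ne_zero (t * I))
    rw [polarCurve] at h4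
    push_cast at h4 ⊢
    linear_combination h4
  simpa using congrArg Complex.im h5

theorem norm_le_one_of_mem_tangentBody (hu : IsConvexRadial u) {z : ℂ}
    (hz : z ∈ tangentBody u) : ‖z‖ ≤ 1 := by
  rw [hu.mem_tangentBody_iff] at hz
  nlinarith [hu.one_le (arg z), norm_nonneg z]

theorem isCompact_tangentBody (hu : IsConvexRadial u) : IsCompact (tangentBody u) :=
  (isCompact_closedBall (0 : ℂ) 1).of_isClosed_subset isClosed_tangentBody fun z hz => by
    simpa using hu.norm_le_one_of_mem_tangentBody hz

theorem mem_interior_tangentBody_iff (hu : IsConvexRadial u) (z : ℂ) :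
    z ∈ interior (tangentBody u) ↔ ‖z‖ * u (arg z) < 1 := by
  constructor
  · intro hz
    rcases eq_or_ne z 0 with rfl | hz0
    · simp
    have hc : ContinuousAt (fun r : ℝ => (r : ℂ) * z) 1 := by fun_prop
    have h1 : ∀ᶠ r : ℝ in nhds 1, (r : ℂ) * z ∈ tangentBody u := by
      apply hc
      simpa using mem_interior_iff_mem_nhds.1 hz
    obtain ⟨ε, hε, h2⟩ := Metric.eventually_nhds_iff.1 h1
    have h3 := h2 (y := 1 + ε / 2) (by rw [Real.dist_eq]; simp [abs_of_pos (half_pos hε), hε])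
    rw [hu.mem_tangentBody_iff, arg_real_mul _ (by positivity), norm_mul, norm_real,
      Real.norm_of_nonneg (by positivity)] at h3
    have : 0 < ‖z‖ * u (arg z) := mul_pos (norm_pos_iff.2 hz0) (hu.pos _)
    nlinarith
  · intro hz
    obtain ⟨M, hM, hM'⟩ := exists_bound_of_periodic hu.contDiff.continuous hu.periodic
    obtain ⟨L, hL, hL'⟩ := exists_bound_of_periodic hu.contDiff_deriv.continuous
      (periodic_deriv hu.periodic)
    rw [mem_interior_iff_mem_nhds, Metric.mem_nhds_iff]
    refine ⟨(1 - ‖z‖ * u (arg z)) / (M + L), by apply div_pos <;> linarith, fun w hw s => ?_⟩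
    rw [Metric.mem_ball, dist_eq_norm, lt_div_iff₀ (by linarith)] at hw
    have h1 : tangentFunctional u s w =
        tangentFunctional u s z + tangentFunctional u s (w - z) := by
      simp [tangentFunctional]
      ring
    have h2 : tangentFunctional u s (w - z) ≤ ‖w - z‖ * (M + L) := by
      rw [tangentFunctional_eq]
      refine mul_le_mul_of_nonneg_left (add_le_add ?_ ?_) (norm_nonneg _)
      · refine (le_abs_self _).trans ?_
        rw [abs_mul]
        nlinarith [hM' s, Real.abs_cos_le_one (arg (w - z) - s), abs_nonneg (u s)]
      · refine (le_abs_self _).trans ?_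
        rw [abs_mul]
        nlinarith [hL' s, Real.abs_sin_le_one (arg (w - z) - s), abs_nonneg (deriv u s)]
    linarith [hu.tangentFunctional_le s z]

theorem zero_mem_interior_tangentBody (hu : IsConvexRadial u) : 0 ∈ interior (tangentBody u) := by
  simp [hu.mem_interior_tangentBody_iff]

theorem range_polarCurve_eq_frontier (hu : IsConvexRadial u) :
    range (polarCurve u) = frontier (tangentBody u) := by
  ext z
  rw [isClosed_tangentBody.frontier_eq, mem_sdiff, hu.mem_tangentBody_iff,
    hu.mem_interior_tangentBody_iff, hu.mem_range_polarCurve_iff, not_lt, le_antisymm_iff]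

theorem isDentedCircle (hu : IsConvexRadial u)
    (h1 : ∀ t, ¬(0 < Real.cos t ∧ 0 < Real.sin t) → u t = 1) :
    IsDentedCircle (range (polarCurve u)) := by
  have hsub {z : ℂ} (hz : z ∈ range (polarCurve u)) : z ∈ tangentBody u := by
    rw [hu.mem_tangentBody_iff, (hu.mem_range_polarCurve_iff z).1 hz]
  have harg {z : ℂ} (hz0 : z ≠ 0) (hz : z ∉ openQuadrant) : u (arg z) = 1 := by
    apply h1
    rintro ⟨h2, h3⟩
    apply hz
    have := norm_pos_iff.2 hz0
    exact ⟨norm_mul_cos_arg z ▸ mul_pos this h2, norm_mul_sin_arg z ▸ mul_pos this h3⟩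
  have hu0 : u 0 = 1 := h1 _ (by simp)
  have hu1 : u (π / 2) = 1 := h1 _ (by simp)
  have key {z w : ℂ} (hz : z ∈ range (polarCurve u)) (hw : w ∈ range (polarCurve u))
      (hzQ : z ∈ openQuadrant) (hre : z.re ≤ w.re) (him : z.im ≤ w.im) : z = w := by
    have hn := (norm_le_one_iff_sq z).1 (hu.norm_le_one_of_mem_tangentBody (hsub hz))
    obtain ⟨hz1, hz2⟩ := hzQ
    have hx : z.re < 1 := by nlinarith
    have hy : z.im < 1 := by nlinarith
    have e1 : tangentFunctional u (arg z) z = 1 := by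
      simpa [tangentFunctional_eq] using (hu.mem_range_polarCurve_iff z).1 hz
    have e2 := hsub hw (arg z)
    have ha := hu.tangent_le (arg z) 0
    have hb := hu.tangent_le (arg z) (π / 2)
    rw [hu0, zero_sub, Real.cos_neg, Real.sin_neg] at ha
    rw [hu1, Real.cos_pi_div_two_sub, Real.sin_pi_div_two_sub] at hb
    unfold tangentFunctional at e1 e2
    obtain ⟨a, hA⟩ : ∃ a, a = u (arg z) * Real.cos (arg z) -
      deriv u (arg z) * Real.sin (arg z) := ⟨_, rfl⟩
    obtain ⟨b, hB⟩ : ∃ b, b = u (arg z) * Real.sin (arg z) +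
      deriv u (arg z) * Real.cos (arg z) := ⟨_, rfl⟩
    rw [← hA, ← hB] at e1 e2
    have ha1 : a ≤ 1 := by linarith
    have hb1 : b ≤ 1 := by linarith
    have ha0 : 0 < a := by
      by_contra! h
      nlinarith
    have hb0 : 0 < b := by
      by_contra! h
      nlinarith
    apply Complex.ext
    · nlinarith
    · nlinarith
  refine ⟨fun z hz => hu.norm_le_one_of_mem_tangentBody (hsub hz), fun z hz hzQ => ?_,
    fun z hz hzQ => ?_, fun z hz w hw hzQ hwQ hne => ?_⟩
  · have h := (hu.mem_range_polarCurve_iff z).1 hz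
    have hz0 : z ≠ 0 := by
      rintro rfl
      simp at h
    simpa [harg hz0 hzQ] using h
  · have hz0 : z ≠ 0 := by
      rintro rfl
      simp at hz
    rw [hu.mem_range_polarCurve_iff, harg hz0 hzQ, hz, one_mul]
  · by_contra! h
    rw [sub_re, sub_im] at h
    rcases mul_nonneg_iff.1 h with ⟨h2, h3⟩ | ⟨h2, h3⟩
    · exact hne (key hw hz hwQ (by linarith) (by linarith)).symm
    · exact hne (key hz hw hzQ (by linarith) (by linarith))

end IsConvexRadial

end PolarCurve

/-! ### A radial function with prescribed contact with the unit circle -/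

section Dent

/-- A smooth function of the angle that is positive on the open first quadrant except for double
zeros at the angles with cosine `(j + 1) / (m + 1)`, `j < m`, and vanishes elsewhere. -/
noncomputable def dent (m : ℕ) (t : ℝ) : ℝ :=
  expNegInvGlue (Real.cos t) * expNegInvGlue (Real.sin t) *
    ∏ j ∈ Finset.range m, (Real.cos t - (j + 1) / (m + 1)) ^ 2

variable (m : ℕ)

theorem contDiff_dent : ContDiff ℝ (⊤ : ℕ∞) (dent m) := by
  have he : ContDiff ℝ (⊤ : ℕ∞) expNegInvGlue := expNegInvGlue.contDiff
  refine ((he.comp Real.contDiff_cos).mul (he.comp Real.contDiff_sin)).mul ?_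
  exact contDiff_prod fun j _ => (Real.contDiff_cos.sub contDiff_const).pow 2

theorem periodic_dent : Function.Periodic (dent m) (2 * π) := by
  intro t
  simp [dent]

theorem dent_nonneg (t : ℝ) : 0 ≤ dent m t :=
  mul_nonneg (mul_nonneg (expNegInvGlue.nonneg _) (expNegInvGlue.nonneg _))
    (Finset.prod_nonneg fun _ _ => sq_nonneg _)

theorem dent_eq_zero_iff (t : ℝ) :
    dent m t = 0 ↔ Real.cos t ≤ 0 ∨ Real.sin t ≤ 0 ∨
      ∃ j < m, Real.cos t = (j + 1) / (m + 1) := by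
  simp [dent, expNegInvGlue.zero_iff_nonpos, Finset.prod_eq_zero_iff, sub_eq_zero, or_assoc]

theorem exists_isConvexRadial_dent : ∃ ε > 0, IsConvexRadial fun t => 1 + ε * dent m t := by
  have hd := (contDiff_infty_iff_deriv.1 (contDiff_dent m))
  have hdd := (contDiff_infty_iff_deriv.1 hd.2)
  obtain ⟨M, hM, hM'⟩ := exists_bound_of_periodic hdd.2.continuous
    (periodic_deriv (periodic_deriv (periodic_dent m)))
  have hε : 0 < M⁻¹ := inv_pos.2 hM
  refine ⟨M⁻¹, hε, contDiff_const.add (contDiff_const.mul (contDiff_dent m)), fun t => ?_,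
    fun t => ?_, fun t => ?_⟩
  · simp only [periodic_dent m t]
  · nlinarith [dent_nonneg m t]
  · have h1 : deriv (fun t => 1 + M⁻¹ * dent m t) = fun t => M⁻¹ * deriv (dent m) t := by
      funext t
      rw [deriv_const_add, deriv_const_mul _ (hd.1 t)]
    rw [h1, deriv_const_mul _ (hdd.1 t)]
    have h2 : M⁻¹ * -deriv (deriv (dent m)) t ≤ M⁻¹ * M :=
      mul_le_mul_of_nonneg_left ((neg_le_abs _).trans (hM' t)) hε.le
    rw [inv_mul_cancel₀ hM.ne'] at h2
    nlinarith [dent_nonneg m t]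

theorem contactSet_eq {ε : ℝ} (hε : 0 < ε) (hu : IsConvexRadial fun t => 1 + ε * dent m t) :
    {z | z ∈ range (polarCurve fun t => 1 + ε * dent m t) ∧ z ∈ openQuadrant ∧ ‖z‖ = 1} =
      (fun j : ℕ => (⟨(j + 1) / (m + 1), √(1 - ((j + 1) / (m + 1)) ^ 2)⟩ : ℂ)) ''
        (Finset.range m : Set ℕ) := by
  ext z
  simp only [mem_ofPred_eq, hu.mem_range_polarCurve_iff]
  constructor
  · rintro ⟨h1, h2, h3⟩
    have h4 : dent m (arg z) = 0 := by
      rw [h3] at h1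
      have : ε * dent m (arg z) = 0 := by linarith
      exact (mul_eq_zero.1 this).resolve_left hε.ne'
    have hre := norm_mul_cos_arg z
    have him := norm_mul_sin_arg z
    rw [h3, one_mul] at hre him
    rw [dent_eq_zero_iff, hre, him] at h4
    rcases h4 with h4 | h4 | ⟨j, hj, h4⟩
    · exact absurd h2.1 h4.not_gt
    · exact absurd h2.2 h4.not_gt
    · refine ⟨j, by simpa using hj, ?_⟩
      rw [norm_eq_one_iff_sq] at h3
      refine Complex.ext h4.symm ?_
      simp only
      rw [← h4, ← Real.sqrt_sq h2.2.le]
      congr 1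
      linarith
  · rintro ⟨j, hj, rfl⟩
    have hj' : (j : ℝ) + 1 < m + 1 := by
      have : j < m := by simpa using hj
      exact_mod_cast Nat.succ_lt_succ this
    have hpos : (0 : ℝ) < (j + 1) / (m + 1) := by positivity
    have hlt : ((j : ℝ) + 1) / (m + 1) < 1 := (div_lt_one (by positivity)).2 hj'
    obtain ⟨c, hc⟩ : ∃ c : ℝ, c = (j + 1) / (m + 1) := ⟨_, rfl⟩
    simp only [← hc] at hpos hlt ⊢
    have hs : 0 < 1 - c ^ 2 := by nlinarith
    have hnorm : ‖(⟨c, √(1 - c ^ 2)⟩ : ℂ)‖ = 1 := by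
      rw [norm_eq_one_iff_sq]
      simp [Real.sq_sqrt hs.le]
    refine ⟨?_, ⟨hpos, Real.sqrt_pos.2 hs⟩, hnorm⟩
    have hre := norm_mul_cos_arg (⟨c, √(1 - c ^ 2)⟩ : ℂ)
    rw [hnorm, one_mul] at hre
    rw [(dent_eq_zero_iff m _).2 (Or.inr (Or.inr ⟨j, by simpa using hj, hre.trans hc⟩)), hnorm]
    simp

theorem ncard_contactPoints :
    ((fun j : ℕ => (⟨(j + 1) / (m + 1), √(1 - ((j + 1) / (m + 1)) ^ 2)⟩ : ℂ)) ''
        (Finset.range m : Set ℕ)).ncard = m := by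
  rw [ncard_image_of_injective, ncard_coe_finset, Finset.card_range]
  intro i j h
  have := congrArg Complex.re h
  have hm : (m : ℝ) + 1 ≠ 0 := by positivity
  simp only [div_left_inj' hm, add_left_inj] at this
  exact_mod_cast this

end Dent

/-- For every positive integer `n` there is an infinitely differentiable simple
closed curve in the plane, bounding a convex region, with exactly `n` inscribed
squares. -/
theorem exists_smooth_convex_curve_with_exactly_n_inscribed_squares
    (n : ℕ) (hn : 1 ≤ n) :
    ∃ (γ : ℝ → ℂ) (K : Set ℂ),
      ContDiff ℝ (⊤ : ℕ∞) γ ∧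
      Function.Periodic γ (2 * π) ∧
      Set.InjOn γ (Set.Ico 0 (2 * π)) ∧
      (∀ t : ℝ, deriv γ t ≠ 0) ∧
      IsCompact K ∧ Convex ℝ K ∧ (interior K).Nonempty ∧
      Set.range γ = frontier K ∧
      (InscribedSquares (Set.range γ)).ncard = n := by
  obtain ⟨m, rfl⟩ : ∃ m, n = m + 1 := ⟨n - 1, by omega⟩
  obtain ⟨ε, hε, hu⟩ := exists_isConvexRadial_dent m
  refine ⟨_, tangentBody _, hu.contDiff_polarCurve, hu.periodic_polarCurve, hu.injOn_polarCurve,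
    hu.deriv_polarCurve_ne_zero, hu.isCompact_tangentBody, convex_tangentBody,
    ⟨0, hu.zero_mem_interior_tangentBody⟩, hu.range_polarCurve_eq_frontier, ?_⟩
  have hC := hu.isDentedCircle fun t ht => by
    rw [(dent_eq_zero_iff m t).2, mul_zero, add_zero]
    rw [not_and_or, not_lt, not_lt] at ht
    tauto
  rw [hC.ncard_inscribedSquares, contactSet_eq m hε hu, ncard_contactPoints]
  rw [contactSet_eq m hε hu]
  exact (Finset.finite_toSet _).image _
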